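/- For every real p ≥ 1, one has ∫₀¹ ∫₀^∞ ∫₀^∞ ( ((p+1)/(2p²))·λ^p·l^p − (1/2)·x·λ^{p−1}·l^{p−1} ) · (2/√(2π))·(x+l)·exp(−(x+l)²/2) dx dl dλ = 0. -/

import Mathlib

open MeasureTheory Set

open Filter Topology

/-- The upper tail integral `∫_l^∞ exp (-u² / 2) du` of the unnormalized Gaussian density. -/
noncomputable def gaussianTail (l : ℝ) : ℝ :=
  ∫ u in Ioi l, Real.exp (-u ^ 2 / 2)

theorem integrable_exp_neg_sq_div_two :
    Integrable fun u : ℝ => Real.exp (-u ^ 2 / 2) := by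
  convert! integrable_exp_neg_mul_sq (b := 1 / 2) (by norm_num) using 3
  ring

theorem integrable_mul_exp_neg_sq_div_two :
    Integrable fun u : ℝ => u * Real.exp (-u ^ 2 / 2) := by
  convert! integrable_mul_exp_neg_mul_sq (b := 1 / 2) (by norm_num) using 4
  ring

theorem integrable_sq_mul_exp_neg_sq_div_two :
    Integrable fun u : ℝ => u ^ 2 * Real.exp (-u ^ 2 / 2) := by
  convert! integrable_rpow_mul_exp_neg_mul_sq (b := 1 / 2) (s := 2) (by norm_num) (by norm_num)
    using 3 with u
  · rw [Real.rpow_two]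
  · ring_nf

theorem integrableOn_rpow_mul_exp_neg_sq_div_two {s : ℝ} (hs : -1 < s) :
    IntegrableOn (fun u : ℝ => u ^ s * Real.exp (-u ^ 2 / 2)) (Ioi 0) := by
  convert! integrableOn_rpow_mul_exp_neg_mul_sq (b := 1 / 2) (by norm_num) hs using 4
  ring

theorem tendsto_rpow_mul_exp_neg_sq_div_two (s : ℝ) :
    Tendsto (fun u : ℝ => u ^ s * Real.exp (-u ^ 2 / 2)) atTop (𝓝 0) := by
  have hexp : Tendsto (fun u : ℝ => Real.exp (-(1 / 2) * u)) atTop (𝓝 0) :=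
    Real.tendsto_exp_atBot.comp (tendsto_id.const_mul_atTop_of_neg (by norm_num))
  have h := (rpow_mul_exp_neg_mul_sq_isLittleO_exp_neg (b := 1 / 2) (by norm_num) s).trans_tendsto
    hexp
  convert h using 4
  ring

theorem hasDerivAt_exp_neg_sq_div_two (u : ℝ) :
    HasDerivAt (fun u : ℝ => Real.exp (-u ^ 2 / 2)) (-u * Real.exp (-u ^ 2 / 2)) u := by
  convert! (((hasDerivAt_id u).pow 2).neg.div_const 2).exp using 1
  simp
  ring

theorem integral_Ioi_comp_add_right_eq (f : ℝ → ℝ) (l : ℝ) :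
    ∫ x in Ioi (0 : ℝ), f (x + l) = ∫ u in Ioi l, f u := by
  have h := (measurePreserving_add_right volume l).setIntegral_preimage_emb
    (measurableEmbedding_addRight l) f (Ioi l)
  simpa using h

theorem integral_Ioi_mul_exp_neg_sq_div_two (l : ℝ) :
    ∫ u in Ioi l, u * Real.exp (-u ^ 2 / 2) = Real.exp (-l ^ 2 / 2) := by
  have h := integral_Ioi_of_hasDerivAt_of_tendsto' (a := l) (m := 0)
    (f := fun u : ℝ => -Real.exp (-u ^ 2 / 2)) (f' := fun u => u * Real.exp (-u ^ 2 / 2))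
    (fun u _ => by simpa using (hasDerivAt_exp_neg_sq_div_two u).fun_neg)
    integrable_mul_exp_neg_sq_div_two.integrableOn
    (by simpa using (tendsto_rpow_mul_exp_neg_sq_div_two 0).neg)
  simpa using h

theorem integrable_sub_mul_mul_exp_neg_sq_div_two (l : ℝ) :
    Integrable fun u : ℝ => (u - l) * (u * Real.exp (-u ^ 2 / 2)) := by
  convert! integrable_sq_mul_exp_neg_sq_div_two.sub
    (integrable_mul_exp_neg_sq_div_two.const_mul l) using 2 with u
  simp
  ring

theorem integral_Ioi_sub_mul_mul_exp_neg_sq_div_two (l : ℝ) :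
    ∫ u in Ioi l, (u - l) * (u * Real.exp (-u ^ 2 / 2)) = gaussianTail l := by
  have hint : Integrable fun u : ℝ =>
      Real.exp (-u ^ 2 / 2) - (u - l) * (u * Real.exp (-u ^ 2 / 2)) :=
    integrable_exp_neg_sq_div_two.sub (integrable_sub_mul_mul_exp_neg_sq_div_two l)
  have h := integral_Ioi_of_hasDerivAt_of_tendsto' (a := l) (m := 0)
    (f := fun u : ℝ => (u - l) * Real.exp (-u ^ 2 / 2))
    (fun u _ => by
      convert! ((hasDerivAt_id u).sub_const l).mul (hasDerivAt_exp_neg_sq_div_two u) using 1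
      simp
      ring)
    hint.integrableOn
    (by
      have h1 := tendsto_rpow_mul_exp_neg_sq_div_two 1
      have h0 := (tendsto_rpow_mul_exp_neg_sq_div_two 0).const_mul l
      simpa [sub_mul] using h1.sub h0)
  rw [integral_sub integrable_exp_neg_sq_div_two.integrableOn
    (integrable_sub_mul_mul_exp_neg_sq_div_two l).integrableOn] at h
  simp only [sub_self, zero_mul] at h
  exact (sub_eq_zero.1 h).symm

theorem hasDerivAt_gaussianTail (l : ℝ) :
    HasDerivAt gaussianTail (-Real.exp (-l ^ 2 / 2)) l := by
  have hcont : Continuous fun u : ℝ => Real.exp (-u ^ 2 / 2) := by fun_prop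
  have htail : gaussianTail =
      fun b => gaussianTail 0 - ∫ u in (0 : ℝ)..b, Real.exp (-u ^ 2 / 2) := by
    ext b
    rw [← intervalIntegral.integral_Ioi_sub_Ioi' integrable_exp_neg_sq_div_two.integrableOn
      integrable_exp_neg_sq_div_two.integrableOn, gaussianTail, gaussianTail, sub_sub_cancel]
  rw [htail]
  exact (hcont.integral_hasStrictDerivAt 0 l).hasDerivAt.const_sub _

theorem gaussianTail_nonneg (l : ℝ) : 0 ≤ gaussianTail l :=
  integral_nonneg fun _ => (Real.exp_pos _).le

theorem gaussianTail_le {l : ℝ} (hl : 0 ≤ l) :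
    gaussianTail l ≤ gaussianTail 0 * Real.exp (-l ^ 2 / 2) := by
  rw [gaussianTail, ← integral_Ioi_comp_add_right_eq (fun u => Real.exp (-u ^ 2 / 2)),
    gaussianTail, ← integral_mul_const]
  refine setIntegral_mono_on (integrable_exp_neg_sq_div_two.comp_add_right l).integrableOn
    (integrable_exp_neg_sq_div_two.mul_const _).integrableOn measurableSet_Ioi fun x hx => ?_
  rw [← Real.exp_add]
  gcongr
  nlinarith [mul_nonneg (le_of_lt (mem_Ioi.1 hx)) hl]

theorem integrableOn_rpow_mul_gaussianTail {s : ℝ} (hs : -1 < s) :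
    IntegrableOn (fun l => l ^ s * gaussianTail l) (Ioi 0) := by
  have hcont : Continuous gaussianTail :=
    continuous_iff_continuousAt.2 fun l => (hasDerivAt_gaussianTail l).continuousAt
  refine ((integrableOn_rpow_mul_exp_neg_sq_div_two hs).const_mul (gaussianTail 0)).mono'
    (by fun_prop) ?_
  filter_upwards [ae_restrict_mem measurableSet_Ioi] with l hl
  have hl : 0 < l := hl
  rw [Real.norm_of_nonneg (mul_nonneg (by positivity) (gaussianTail_nonneg l)), mul_left_comm]
  gcongr
  exact gaussianTail_le hl.le

theorem integral_rpow_sub_one_mul_gaussianTail {p : ℝ} (hp : 0 < p) :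
    ∫ l in Ioi (0 : ℝ), l ^ (p - 1) * gaussianTail l =
      (∫ l in Ioi (0 : ℝ), l ^ p * Real.exp (-l ^ 2 / 2)) / p := by
  have hG := (integrableOn_rpow_mul_gaussianTail (s := p - 1) (by linarith)).const_mul p
  have hE := integrableOn_rpow_mul_exp_neg_sq_div_two (s := p) (by linarith)
  have hlim : Tendsto (fun l => l ^ p * gaussianTail l) atTop (𝓝 0) := by
    have hbound := (tendsto_rpow_mul_exp_neg_sq_div_two p).const_mul (gaussianTail 0)
    rw [mul_zero] at hbound
    refine squeeze_zero' ?_ ?_ hbound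
    · filter_upwards [eventually_ge_atTop 0] with l hl
      exact mul_nonneg (by positivity) (gaussianTail_nonneg l)
    · filter_upwards [eventually_ge_atTop 0] with l hl
      rw [mul_left_comm]
      gcongr
      exact gaussianTail_le hl
  have h := integral_Ioi_of_hasDerivAt_of_tendsto (a := 0)
    (f := fun l => l ^ p * gaussianTail l)
    (f' := fun l => p * (l ^ (p - 1) * gaussianTail l) - l ^ p * Real.exp (-l ^ 2 / 2))
    ((Real.continuousAt_rpow_const 0 p (Or.inr hp.le)).mul
      (hasDerivAt_gaussianTail 0).continuousAt).continuousWithinAt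
    (fun l hl => by
      convert! (Real.hasDerivAt_rpow_const (p := p) (Or.inl (ne_of_gt hl))).mul
        (hasDerivAt_gaussianTail l) using 1
      ring)
    (hG.sub hE) hlim
  rw [integral_sub hG hE, integral_const_mul, Real.zero_rpow hp.ne'] at h
  rw [eq_div_iff hp.ne']
  linarith

/-- The inner integral against the (unnormalized) joint density of `(|B₁|, L₁)`. -/
theorem integral_Ioi_sub_mul_mul_density (a b c l : ℝ) :
    ∫ x in Ioi (0 : ℝ), (a - b * x) * (c * (x + l) * Real.exp (-(x + l) ^ 2 / 2)) =
      c * (a * Real.exp (-l ^ 2 / 2) - b * gaussianTail l) := by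
  have h := integral_Ioi_comp_add_right_eq
    (fun u => (a * c) * (u * Real.exp (-u ^ 2 / 2)) -
      (b * c) * ((u - l) * (u * Real.exp (-u ^ 2 / 2)))) l
  rw [integral_sub (integrable_mul_exp_neg_sq_div_two.const_mul _).integrableOn
    ((integrable_sub_mul_mul_exp_neg_sq_div_two l).const_mul _).integrableOn,
    integral_const_mul, integral_const_mul, integral_Ioi_mul_exp_neg_sq_div_two,
    integral_Ioi_sub_mul_mul_exp_neg_sq_div_two] at h
  calc _ = _ := by
        refine integral_congr_ae (ae_of_all _ fun x => ?_)
        simp only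
        ring
    _ = _ := h
    _ = _ := by ring

theorem centered_functionals (p : ℝ) (hp : 1 ≤ p) :
    ∫ lam in (0:ℝ)..1, ∫ l in Ioi (0:ℝ), ∫ x in Ioi (0:ℝ),
        (((p + 1) / (2 * p ^ 2)) * lam ^ p * l ^ p -
            (1 / 2) * x * lam ^ (p - 1) * l ^ (p - 1)) *
          ((2 / Real.sqrt (2 * Real.pi)) * (x + l) * Real.exp (-(x + l) ^ 2 / 2))
      = 0 := by
  have hp0 : 0 < p := by linarith
  set c : ℝ := 2 / Real.sqrt (2 * Real.pi)
  set M : ℝ := ∫ l in Ioi (0 : ℝ), l ^ p * Real.exp (-l ^ 2 / 2)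
  have hinner (lam l : ℝ) : ∫ x in Ioi (0:ℝ),
        (((p + 1) / (2 * p ^ 2)) * lam ^ p * l ^ p -
            (1 / 2) * x * lam ^ (p - 1) * l ^ (p - 1)) *
          (c * (x + l) * Real.exp (-(x + l) ^ 2 / 2)) =
      c * ((p + 1) / (2 * p ^ 2) * lam ^ p) * (l ^ p * Real.exp (-l ^ 2 / 2)) -
        c * (1 / 2 * lam ^ (p - 1)) * (l ^ (p - 1) * gaussianTail l) := by
    rw [show c * ((p + 1) / (2 * p ^ 2) * lam ^ p) * (l ^ p * Real.exp (-l ^ 2 / 2)) -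
        c * (1 / 2 * lam ^ (p - 1)) * (l ^ (p - 1) * gaussianTail l) =
      c * ((p + 1) / (2 * p ^ 2) * lam ^ p * l ^ p * Real.exp (-l ^ 2 / 2) -
        (1 / 2 * lam ^ (p - 1) * l ^ (p - 1)) * gaussianTail l) by ring,
      ← integral_Ioi_sub_mul_mul_density]
    refine integral_congr_ae (ae_of_all _ fun x => ?_)
    simp only
    ring
  have hmiddle (lam : ℝ) : ∫ l in Ioi (0 : ℝ),
      (c * ((p + 1) / (2 * p ^ 2) * lam ^ p) * (l ^ p * Real.exp (-l ^ 2 / 2)) -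
        c * (1 / 2 * lam ^ (p - 1)) * (l ^ (p - 1) * gaussianTail l)) =
      c * M * ((p + 1) / (2 * p ^ 2)) * lam ^ p - c * M / (2 * p) * lam ^ (p - 1) := by
    rw [integral_sub
      ((integrableOn_rpow_mul_exp_neg_sq_div_two (by linarith)).const_mul _)
      ((integrableOn_rpow_mul_gaussianTail (by linarith)).const_mul _),
      integral_const_mul, integral_const_mul, integral_rpow_sub_one_mul_gaussianTail hp0]
    ring
  simp_rw [hinner, hmiddle]
  rw [intervalIntegral.integral_sub
    ((intervalIntegral.intervalIntegrable_rpow' (by linarith)).const_mul _)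
    ((intervalIntegral.intervalIntegrable_rpow' (by linarith)).const_mul _),
    intervalIntegral.integral_const_mul, intervalIntegral.integral_const_mul,
    integral_rpow (Or.inl (by linarith)), integral_rpow (Or.inl (by linarith)),
    sub_add_cancel, Real.one_rpow, Real.one_rpow, Real.zero_rpow hp0.ne',
    Real.zero_rpow (by linarith)]
  have hp1 : p + 1 ≠ 0 := by linarith
  field_simp
  ring
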